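/- Let n ≥ 3 and q = ⌊n/3⌋, and for each integer k ≥ 0 let p_{n,k} denote the number of preference orders σ ∈ {±1}^n with ν_max(σ) = k. Then p_{n,k} = 4·C(n,k) for 0 ≤ k < q; p_{n,q} = 2^n − 4·∑_{i=0}^{q−1} C(n,i); and p_{n,k} = 0 for k > q. -/

import Mathlib

namespace Napkin

variable {n q : ℕ}

/-- The napkin to the left of seat `s`; napkin `s` itself is the one to the right of
seat `s`, placed between seats `s` and `s + 1` around the circular table. -/
def leftNapkin (s : Fin n) : Fin n := ⟨((s : ℕ) + (n - 1)) % n, Nat.mod_lt _ s.pos⟩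

/-- Process the diners `0, 1, …, n-1` in their arrival order.  Here `w i = j` means that
diner `j` sits in seat `i` (so diner `j` sits in seat `w.symm j`), and `σ j = true`
means diner `j` prefers the napkin to their right.  Each diner takes their preferred
adjacent napkin if it is unclaimed, otherwise the other adjacent napkin if it is
unclaimed, and otherwise is napkinless.  The returned state consists of the set of
claimed napkins and the set of napkinless diners. -/
def dine (σ : Fin n → Bool) (w : Equiv.Perm (Fin n)) :
    Finset (Fin n) × Finset (Fin n) :=
  (List.finRange n).foldl
    (fun st j =>
      let s := w.symm j
      let pref := if σ j then s else leftNapkin s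
      let other := if σ j then leftNapkin s else s
      if pref ∉ st.1 then (insert pref st.1, st.2)
      else if other ∉ st.1 then (insert other st.1, st.2)
      else (st.1, insert j st.2))
    (∅, ∅)

/-- The set of napkinless diners for the seating arrangement `(w, σ)`. -/
def napkinless (σ : Fin n → Bool) (w : Equiv.Perm (Fin n)) : Finset (Fin n) :=
  (dine σ w).2

/-- `ν(w,σ)`, the number of napkinless diners. -/
def nu (σ : Fin n → Bool) (w : Equiv.Perm (Fin n)) : ℕ := (napkinless σ w).card

/-- A seating order puts diner `1` in seat `1` (index `0` here). -/
def IsSeating (w : Equiv.Perm (Fin n)) : Prop :=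
  ∀ i : Fin n, (i : ℕ) = 0 → (w i : ℕ) = 0

instance : DecidablePred (IsSeating (n := n)) := fun w =>
  decidable_of_iff (∀ i : Fin n, (i : ℕ) = 0 → (w i : ℕ) = 0) Iff.rfl

/-- `ν_max(σ)`, the maximal number of napkinless diners over all seating orders. -/
def nuMax (σ : Fin n → Bool) : ℕ :=
  (Finset.univ.filter fun w : Equiv.Perm (Fin n) => IsSeating w).sup (nu σ)

/-- The value `±1` of a napkin preference. -/
def sign (b : Bool) : ℤ := if b then 1 else -1

/-- The drift `h(σ) = max(0, max over prefixes of σ₁ + ⋯ + σᵢ)`. -/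
def drift (σ : Fin n → Bool) : ℕ :=
  (Finset.range (n + 1)).sup fun i =>
    (∑ j ∈ Finset.univ.filter (fun j : Fin n => (j : ℕ) < i), sign (σ j)).toNat

/-- A bench collection: `q` pairwise disjoint triples `aᵢ < bᵢ < cᵢ` in `{1,…,n}`. -/
structure BenchCollection (n q : ℕ) where
  a : Fin q → Fin n
  b : Fin q → Fin n
  c : Fin q → Fin n
  hab : ∀ i, a i < b i
  hbc : ∀ i, b i < c i
  disj : ∀ i j : Fin q, i ≠ j →
    Disjoint ({a i, b i, c i} : Finset (Fin n)) ({a j, b j, c j} : Finset (Fin n))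

/-- A bench is balanced when its two smallest members have opposite preferences. -/
def Balanced (σ : Fin n → Bool) (β : BenchCollection n q) (i : Fin q) : Prop :=
  sign (σ (β.a i)) + sign (σ (β.b i)) = 0

instance (σ : Fin n → Bool) (β : BenchCollection n q) :
    DecidablePred (Balanced σ β) := fun i =>
  decidable_of_iff (sign (σ (β.a i)) + sign (σ (β.b i)) = 0) Iff.rfl

/-- `b(β,σ)`, the number of balanced benches of `β`. -/
def balance (σ : Fin n → Bool) (β : BenchCollection n q) : ℕ :=
  (Finset.univ.filter fun i => Balanced σ β i).card

/-! ### The run of the process -/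

lemma leftNapkin_inj : Function.Injective (leftNapkin (n := n)) := by
  intro a b h
  have ha := a.2
  have hb := b.2
  simp only [leftNapkin, Fin.mk.injEq] at h
  have h1 : ((a : ℕ) + (n - 1)) ≡ ((b : ℕ) + (n - 1)) [MOD n] := h
  have h2 : (a : ℕ) ≡ b [MOD n] := Nat.ModEq.add_right_cancel' _ h1
  exact Fin.ext (Nat.ModEq.eq_of_lt_of_lt h2 ha hb)

structure Inv (σ : Fin n → Bool) (s : Fin n → Fin n) (D C N R L : Finset (Fin n)) : Prop where
  hD : ∀ j, j ∈ D ↔ j ∈ R ∨ j ∈ L ∨ j ∈ N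
  hRL : ∀ j, j ∈ R → j ∉ L
  hRN : ∀ j, j ∈ R → j ∉ N
  hLN : ∀ j, j ∈ L → j ∉ N
  hC : ∀ x, x ∈ C ↔ (∃ r ∈ R, s r = x) ∨ (∃ l ∈ L, leftNapkin (s l) = x)
  hne : ∀ r ∈ R, ∀ l ∈ L, s r ≠ leftNapkin (s l)
  h1 : ∀ j, (j ∈ N ∨ (j ∈ R ∧ σ j = false)) → ∃ r ∈ R, r < j ∧ s r = leftNapkin (s j)
  h2 : ∀ j, (j ∈ N ∨ (j ∈ L ∧ σ j = true)) → ∃ l ∈ L, l < j ∧ leftNapkin (s l) = s j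

section steps
variable {σ : Fin n → Bool} {s : Fin n → Fin n} {D C N R L : Finset (Fin n)} {j : Fin n}

lemma Inv.left_taken (I : Inv σ s D C N R L) (hs : Function.Injective s)
    (hj : ∀ i ∈ D, i < j) (h : leftNapkin (s j) ∈ C) :
    ∃ r ∈ R, r < j ∧ s r = leftNapkin (s j) := by
  rcases (I.hC _).1 h with ⟨r, hr, e⟩ | ⟨l, hl, e⟩
  · exact ⟨r, hr, hj r ((I.hD r).2 (Or.inl hr)), e⟩
  · have := hs (leftNapkin_inj e)
    subst this
    exact absurd (hj l ((I.hD l).2 (Or.inr (Or.inl hl)))) (lt_irrefl _)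

lemma Inv.right_taken (I : Inv σ s D C N R L) (hs : Function.Injective s)
    (hj : ∀ i ∈ D, i < j) (h : s j ∈ C) :
    ∃ l ∈ L, l < j ∧ leftNapkin (s l) = s j := by
  rcases (I.hC _).1 h with ⟨r, hr, e⟩ | ⟨l, hl, e⟩
  · have := hs e
    subst this
    exact absurd (hj r ((I.hD r).2 (Or.inl hr))) (lt_irrefl _)
  · exact ⟨l, hl, hj l ((I.hD l).2 (Or.inr (Or.inl hl))), e⟩

lemma Inv.takeR (I : Inv σ s D C N R L) (hs : Function.Injective s)
    (hj : ∀ i ∈ D, i < j) (h : s j ∉ C) (h' : σ j = false → leftNapkin (s j) ∈ C) :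
    Inv σ s (insert j D) (insert (s j) C) N (insert j R) L := by
  have hjD : j ∉ D := fun h => lt_irrefl _ (hj j h)
  have hjj : j ∉ R ∧ j ∉ L ∧ j ∉ N := by
    have := I.hD j; tauto
  refine ⟨?_, ?_, ?_, I.hLN, ?_, ?_, ?_, ?_⟩
  · intro i; have := I.hD i; simp only [Finset.mem_insert]; tauto
  · intro i hi; rcases Finset.mem_insert.1 hi with rfl | hi
    · exact hjj.2.1
    · exact I.hRL i hi
  · intro i hi; rcases Finset.mem_insert.1 hi with rfl | hi
    · exact hjj.2.2
    · exact I.hRN i hi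
  · intro x
    rw [Finset.mem_insert, I.hC x, Finset.exists_mem_insert, or_assoc, eq_comm (a := x)]
  · intro r hr l hl e
    rcases Finset.mem_insert.1 hr with rfl | hr
    · exact h ((I.hC _).2 (Or.inr ⟨l, hl, e.symm⟩))
    · exact I.hne r hr l hl e
  · intro i hi
    have key : ∃ r ∈ R, r < i ∧ s r = leftNapkin (s i) := by
      rcases hi with hi | ⟨hi, hσ⟩
      · exact I.h1 i (Or.inl hi)
      · rcases Finset.mem_insert.1 hi with rfl | hi
        · exact I.left_taken hs hj (h' hσ)
        · exact I.h1 i (Or.inr ⟨hi, hσ⟩)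
    obtain ⟨r, hr, e⟩ := key
    exact ⟨r, Finset.mem_insert_of_mem hr, e⟩
  · exact I.h2

lemma Inv.takeL (I : Inv σ s D C N R L) (hs : Function.Injective s)
    (hj : ∀ i ∈ D, i < j) (h : leftNapkin (s j) ∉ C) (h' : σ j = true → s j ∈ C) :
    Inv σ s (insert j D) (insert (leftNapkin (s j)) C) N R (insert j L) := by
  have hjD : j ∉ D := fun h => lt_irrefl _ (hj j h)
  have hjj : j ∉ R ∧ j ∉ L ∧ j ∉ N := by
    have := I.hD j; tauto
  refine ⟨?_, ?_, I.hRN, ?_, ?_, ?_, ?_, ?_⟩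
  · intro i; have := I.hD i; simp only [Finset.mem_insert]; tauto
  · intro i hi hi'; rcases Finset.mem_insert.1 hi' with rfl | hi'
    · exact hjj.1 hi
    · exact I.hRL i hi hi'
  · intro i hi; rcases Finset.mem_insert.1 hi with rfl | hi
    · exact hjj.2.2
    · exact I.hLN i hi
  · intro x
    rw [Finset.mem_insert, I.hC x, Finset.exists_mem_insert, or_left_comm, eq_comm (a := x)]
  · intro r hr l hl e
    rcases Finset.mem_insert.1 hl with rfl | hl
    · exact h ((I.hC _).2 (Or.inl ⟨r, hr, e⟩))
    · exact I.hne r hr l hl e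
  · exact I.h1
  · intro i hi
    have key : ∃ l ∈ L, l < i ∧ leftNapkin (s l) = s i := by
      rcases hi with hi | ⟨hi, hσ⟩
      · exact I.h2 i (Or.inl hi)
      · rcases Finset.mem_insert.1 hi with rfl | hi
        · exact I.right_taken hs hj (h' hσ)
        · exact I.h2 i (Or.inr ⟨hi, hσ⟩)
    obtain ⟨r, hr, e⟩ := key
    exact ⟨r, Finset.mem_insert_of_mem hr, e⟩

lemma Inv.takeN (I : Inv σ s D C N R L) (hs : Function.Injective s)
    (hj : ∀ i ∈ D, i < j) (h : leftNapkin (s j) ∈ C) (h' : s j ∈ C) :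
    Inv σ s (insert j D) C (insert j N) R L := by
  have hjD : j ∉ D := fun h => lt_irrefl _ (hj j h)
  have hjj : j ∉ R ∧ j ∉ L ∧ j ∉ N := by
    have := I.hD j; tauto
  refine ⟨?_, I.hRL, ?_, ?_, I.hC, I.hne, ?_, ?_⟩
  · intro i; have := I.hD i; simp only [Finset.mem_insert]; tauto
  · intro i hi hi'; rcases Finset.mem_insert.1 hi' with rfl | hi'
    · exact hjj.1 hi
    · exact I.hRN i hi hi'
  · intro i hi hi'; rcases Finset.mem_insert.1 hi' with rfl | hi'
    · exact hjj.2.1 hi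
    · exact I.hLN i hi hi'
  · intro i hi
    by_cases e : i = j
    · subst e; exact I.left_taken hs hj h
    · simp only [Finset.mem_insert, e, false_or] at hi
      exact I.h1 i hi
  · intro i hi
    by_cases e : i = j
    · subst e; exact I.right_taken hs hj h'
    · simp only [Finset.mem_insert, e, false_or] at hi
      exact I.h2 i hi

end steps

lemma inv_foldl (σ : Fin n → Bool) (w : Equiv.Perm (Fin n)) (l : List (Fin n))
    (hl : l.Pairwise (· < ·)) :
    ∃ R L, Inv σ w.symm l.toFinset
      (l.foldl
    (fun st j =>
      let s := w.symm j
      let pref := if σ j then s else leftNapkin s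
      let other := if σ j then leftNapkin s else s
      if pref ∉ st.1 then (insert pref st.1, st.2)
      else if other ∉ st.1 then (insert other st.1, st.2)
      else (st.1, insert j st.2))
    ((∅, ∅) : Finset (Fin n) × Finset (Fin n))).1
      (l.foldl
    (fun st j =>
      let s := w.symm j
      let pref := if σ j then s else leftNapkin s
      let other := if σ j then leftNapkin s else s
      if pref ∉ st.1 then (insert pref st.1, st.2)
      else if other ∉ st.1 then (insert other st.1, st.2)
      else (st.1, insert j st.2))
    ((∅, ∅) : Finset (Fin n) × Finset (Fin n))).2 R L := by
  induction l using List.reverseRecOn with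
  | nil => exact ⟨∅, ∅, by constructor <;> simp⟩
  | append_singleton l j ih =>
    rw [List.pairwise_append] at hl
    obtain ⟨R, L, I⟩ := ih hl.1
    have hj : ∀ i ∈ l.toFinset, i < j := fun i hi => hl.2.2 i (List.mem_toFinset.1 hi) j (by simp)
    rw [List.foldl_append]
    have e : (l ++ [j]).toFinset = insert j l.toFinset := by ext; simp
    rw [e]
    revert I
    generalize (l.foldl _ ((∅, ∅) : Finset (Fin n) × Finset (Fin n))) = st
    intro I
    obtain ⟨C, N⟩ := st
    simp only [List.foldl_cons, List.foldl_nil]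
    have hs := w.symm.injective
    dsimp only at I
    cases hσ : σ j
    · simp only [Bool.false_eq_true, if_false]
      by_cases h1 : leftNapkin (w.symm j) ∈ C
      · by_cases h2 : w.symm j ∈ C
        · simp only [h1, h2, not_true, if_false]
          exact ⟨_, _, I.takeN hs hj h1 h2⟩
        · simp only [h1, h2, not_true, if_false, not_false_eq_true, if_true]
          exact ⟨_, _, I.takeR hs hj h2 (fun _ => h1)⟩
      · simp only [h1, not_false_eq_true, if_true]
        exact ⟨_, _, I.takeL hs hj h1 (by simp [hσ])⟩
    · simp only [if_true]
      by_cases h2 : w.symm j ∈ C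
      · by_cases h1 : leftNapkin (w.symm j) ∈ C
        · simp only [h1, h2, not_true, if_false]
          exact ⟨_, _, I.takeN hs hj h1 h2⟩
        · simp only [h1, h2, not_true, if_false, not_false_eq_true, if_true]
          exact ⟨_, _, I.takeL hs hj h1 (fun _ => h2)⟩
      · simp only [h2, not_false_eq_true, if_true]
        exact ⟨_, _, I.takeR hs hj h2 (by simp [hσ])⟩

lemma inv_dine (σ : Fin n → Bool) (w : Equiv.Perm (Fin n)) :
    ∃ C R L, Inv σ w.symm Finset.univ C (napkinless σ w) R L := by
  obtain ⟨R, L, I⟩ := inv_foldl σ w (List.finRange n) (List.pairwise_lt_finRange n)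
  have e : (List.finRange n).toFinset = Finset.univ := by ext; simp
  rw [e] at I
  exact ⟨_, R, L, I⟩

/-- number of diners among the first `t` with preference `b` -/
def cnt (σ : Fin n → Bool) (b : Bool) (t : ℕ) : ℕ :=
  (Finset.univ.filter (fun j : Fin n => (j : ℕ) < t ∧ σ j = b)).card

lemma Inv.bound (σ : Fin n → Bool) (w : Equiv.Perm (Fin n)) {C N R L : Finset (Fin n)}
    (I : Inv σ w.symm Finset.univ C N R L) (b : Bool) (t : ℕ) :
    (N.filter (fun j : Fin n => (j : ℕ) < t)).card ≤
      (Finset.univ.filter (fun j : Fin n => ((j : ℕ) < t ∧ σ j = b) ∧ j ∉ N)).card := by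
  classical
  -- generic counting argument
  have gen : ∀ (X : Finset (Fin n)) (f g : Fin n → Fin n), Function.Injective f →
      (∀ j ∈ X, j ∉ N) →
      (∀ j, (j ∈ N ∨ (j ∈ X ∧ σ j = !b)) → ∃ r ∈ X, r < j ∧ g r = f j) →
      (N.filter (fun j : Fin n => (j : ℕ) < t)).card ≤
      (Finset.univ.filter (fun j : Fin n => ((j : ℕ) < t ∧ σ j = b) ∧ j ∉ N)).card := by
    intro X f g hf hX h
    set X1 := X.filter (fun j : Fin n => (j : ℕ) < t ∧ σ j = b)
    set X2 := X.filter (fun j : Fin n => (j : ℕ) < t ∧ σ j = !b)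
    set N1 := N.filter (fun j : Fin n => (j : ℕ) < t)
    have hd : Disjoint N1 X2 := by
      rw [Finset.disjoint_left]; intro j hj hj'
      simp only [N1, X2, Finset.mem_filter] at hj hj'
      exact hX j hj'.1 hj.1
    have hd2 : Disjoint X1 X2 := by
      rw [Finset.disjoint_left]; intro j hj hj'
      simp only [X1, X2, Finset.mem_filter] at hj hj'
      rw [hj.2.2] at hj'; simp at hj'
    have hsub : (N1 ∪ X2).image f ⊆ (X1 ∪ X2).image g := by
      intro y hy
      obtain ⟨j, hj, rfl⟩ := Finset.mem_image.1 hy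
      have hjt : (j : ℕ) < t := by
        simp only [N1, X2, Finset.mem_union, Finset.mem_filter] at hj; tauto
      obtain ⟨r, hr, hlt, e⟩ := h j (by
        simp only [N1, X2, Finset.mem_union, Finset.mem_filter] at hj; tauto)
      refine Finset.mem_image.2 ⟨r, ?_, e⟩
      have : (r : ℕ) < t := lt_trans hlt hjt
      simp only [X1, X2, Finset.mem_union, Finset.mem_filter]
      cases σ r <;> cases b <;> simp_all
    have h1 := Finset.card_le_card hsub
    rw [Finset.card_image_of_injective _ hf, Finset.card_union_of_disjoint hd] at h1
    have h2 := h1.trans Finset.card_image_le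
    rw [Finset.card_union_of_disjoint hd2] at h2
    have h3 : N1.card ≤ X1.card := by omega
    refine h3.trans (Finset.card_le_card ?_)
    intro j hj
    simp only [X1, Finset.mem_filter] at hj
    simp only [Finset.mem_filter, Finset.mem_univ, true_and]
    exact ⟨hj.2, hX j hj.1⟩
  cases b
  · refine gen L w.symm (fun j => leftNapkin (w.symm j)) w.symm.injective I.hLN ?_
    simpa using I.h2
  · refine gen R (fun j => leftNapkin (w.symm j)) w.symm (leftNapkin_inj.comp w.symm.injective)
      I.hRN ?_
    simpa using I.h1

lemma cnt_add (σ : Fin n → Bool) (t : ℕ) (ht : t ≤ n) :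
    cnt σ true t + cnt σ false t = t := by
  classical
  unfold cnt
  rw [← Finset.card_union_of_disjoint]
  · have : (Finset.univ.filter (fun j : Fin n => (j : ℕ) < t ∧ σ j = true)) ∪
      (Finset.univ.filter (fun j : Fin n => (j : ℕ) < t ∧ σ j = false)) =
      Finset.univ.filter (fun j : Fin n => (j : ℕ) < t) := by
      ext j; simp only [Finset.mem_union, Finset.mem_filter]; cases σ j <;> simp
    rw [this, Fin.card_filter_val_lt]; omega
  · rw [Finset.disjoint_left]; intro j hj hj'
    simp only [Finset.mem_filter] at hj hj'
    rw [hj.2.2] at hj'; simp at hj'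

lemma cnt_mono (σ : Fin n → Bool) (b : Bool) {t t' : ℕ} (h : t ≤ t') :
    cnt σ b t ≤ cnt σ b t' := by
  apply Finset.card_le_card
  intro j; simp only [Finset.mem_filter]; rintro ⟨h1, h2, h3⟩; exact ⟨h1, by omega, h3⟩

/-- `|S_t| ≤ n - 2k` for all `t`. -/
def Good (σ : Fin n → Bool) (k : ℕ) : Prop :=
  ∀ t ≤ n, cnt σ true t + 2 * k ≤ n + cnt σ false t ∧ cnt σ false t + 2 * k ≤ n + cnt σ true t

lemma upper_aux (σ : Fin n → Bool) (N : Finset (Fin n)) (b : Bool)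
    (hb : ∀ t, (N.filter (fun j : Fin n => (j : ℕ) < t)).card ≤
      (Finset.univ.filter (fun j : Fin n => ((j : ℕ) < t ∧ σ j = b) ∧ j ∉ N)).card)
    (t : ℕ) (ht : t ≤ n) : 2 * N.card ≤ 2 * cnt σ b t + (n - t) := by
  classical
  have e1 := hb t
  have e2 := hb n
  have c1 : (N.filter (fun j : Fin n => (j : ℕ) < t)).card + (N.filter (fun j : Fin n => ¬ (j : ℕ) < t)).card
      = N.card := Finset.card_filter_add_card_filter_not _
  have c2 : (N.filter (fun j : Fin n => (j : ℕ) < n)).card = N.card := by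
    congr 1; ext j; simp
  have c3 : (Finset.univ.filter (fun j : Fin n => ((j : ℕ) < t ∧ σ j = b) ∧ j ∉ N)).card
      ≤ cnt σ b t := by
    apply Finset.card_le_card; intro j; simp only [Finset.mem_filter]; tauto
  have c4 : (Finset.univ.filter (fun j : Fin n => ((j : ℕ) < n ∧ σ j = b) ∧ j ∉ N)).card ≤
      (Finset.univ.filter (fun j : Fin n => ((j : ℕ) < t ∧ σ j = b) ∧ j ∉ N)).card +
      (Finset.univ.filter (fun j : Fin n => (¬ (j : ℕ) < t) ∧ j ∉ N)).card := by
    refine le_trans (Finset.card_le_card ?_) (Finset.card_union_le _ _)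
    intro j; simp only [Finset.mem_filter, Finset.mem_union]; tauto
  have c5 : (N.filter (fun j : Fin n => ¬ (j : ℕ) < t)).card +
      (Finset.univ.filter (fun j : Fin n => (¬ (j : ℕ) < t) ∧ j ∉ N)).card ≤ n - t := by
    rw [← Finset.card_union_of_disjoint]
    · have h1 : (Finset.univ.filter (fun j : Fin n => (j : ℕ) < t)).card +
        (Finset.univ.filter (fun j : Fin n => ¬ (j : ℕ) < t)).card = _ :=
        Finset.card_filter_add_card_filter_not _
      rw [Fin.card_filter_val_lt, Finset.card_univ, Fintype.card_fin] at h1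
      have h2 : (N.filter (fun j : Fin n => ¬ (j : ℕ) < t)) ∪
        (Finset.univ.filter (fun j : Fin n => (¬ (j : ℕ) < t) ∧ j ∉ N)) ⊆
        (Finset.univ.filter (fun j : Fin n => ¬ (j : ℕ) < t)) := by
        intro j; simp only [Finset.mem_filter, Finset.mem_union, Finset.mem_univ]; tauto
      have := Finset.card_le_card h2
      omega
    · rw [Finset.disjoint_left]; intro j; simp only [Finset.mem_filter]; tauto
  omega

lemma nu_upper (σ : Fin n → Bool) (w : Equiv.Perm (Fin n)) :
    3 * nu σ w ≤ n ∧ Good σ (nu σ w) := by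
  classical
  obtain ⟨C, R, L, I⟩ := inv_dine σ w
  unfold nu
  set N := napkinless σ w
  have B := I.bound σ w
  constructor
  · have e1 := B true n
    have e2 := B false n
    have c2 : (N.filter (fun j : Fin n => (j : ℕ) < n)).card = N.card := by
      congr 1; ext j; simp
    have : (Finset.univ.filter (fun j : Fin n => ((j : ℕ) < n ∧ σ j = true) ∧ j ∉ N)).card +
      (Finset.univ.filter (fun j : Fin n => ((j : ℕ) < n ∧ σ j = false) ∧ j ∉ N)).card
       = Nᶜ.card := by
      rw [← Finset.card_union_of_disjoint]
      · congr 1; ext j; simp only [Finset.mem_union, Finset.mem_filter, Finset.mem_compl]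
        cases σ j <;> simp
      · rw [Finset.disjoint_left]; intro j; simp only [Finset.mem_filter]
        cases σ j <;> simp
    have h3 := Finset.card_add_card_compl N
    rw [Fintype.card_fin] at h3
    omega
  · intro t ht
    have h1 := upper_aux σ N true (B true) t ht
    have h2 := upper_aux σ N false (B false) t ht
    have h3 := cnt_add σ t ht
    omega

/-! ### Constructing seatings -/

def firstK (P : Finset (Fin n)) (k : ℕ) : Finset (Fin n) :=
  P.filter (fun j : Fin n => (P.filter (fun i : Fin n => (i : ℕ) < (j : ℕ))).card < k)

lemma filter_lt_succ (P : Finset (Fin n)) (t : ℕ) (ht : t < n) :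
    (P.filter (fun i : Fin n => (i : ℕ) < t + 1)).card =
      (P.filter (fun i : Fin n => (i : ℕ) < t)).card + if (⟨t, ht⟩ : Fin n) ∈ P then 1 else 0 := by
  classical
  split_ifs with h
  · have : P.filter (fun i : Fin n => (i : ℕ) < t + 1) =
        insert (⟨t, ht⟩ : Fin n) (P.filter (fun i : Fin n => (i : ℕ) < t)) := by
      ext i
      simp only [Finset.mem_filter, Finset.mem_insert, Fin.ext_iff]
      constructor
      · rintro ⟨h1, h2⟩
        by_cases e : (i : ℕ) = t
        · exact Or.inl e
        · exact Or.inr ⟨h1, by omega⟩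
      · rintro (h1 | h1)
        · have : i = ⟨t, ht⟩ := Fin.ext h1
          subst this; exact ⟨h, by simp⟩
        · exact ⟨h1.1, by omega⟩
    rw [this, Finset.card_insert_of_notMem (by simp)]
  · congr 1
    ext i
    simp only [Finset.mem_filter]
    constructor
    · rintro ⟨h1, h2⟩
      refine ⟨h1, ?_⟩
      by_contra h3
      have : i = ⟨t, ht⟩ := Fin.ext (by simp; omega)
      subst this; exact h h1
    · rintro ⟨h1, h2⟩; exact ⟨h1, by omega⟩

lemma card_firstK (P : Finset (Fin n)) (k : ℕ) (t : ℕ) (ht : t ≤ n) :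
    ((firstK P k).filter (fun i : Fin n => (i : ℕ) < t)).card =
      min k (P.filter (fun i : Fin n => (i : ℕ) < t)).card := by
  induction t with
  | zero => simp
  | succ t ih =>
    rw [filter_lt_succ _ _ ht, filter_lt_succ _ _ ht, ih (by omega)]
    have : ((⟨t, ht⟩ : Fin n) ∈ firstK P k) ↔ (⟨t, ht⟩ : Fin n) ∈ P ∧
      (P.filter (fun i : Fin n => (i : ℕ) < t)).card < k := by
      simp only [firstK, Finset.mem_filter]
    simp only [this]
    by_cases h1 : (⟨t, ht⟩ : Fin n) ∈ P <;>
    by_cases h2 : (P.filter (fun i : Fin n => (i : ℕ) < t)).card < k <;> simp [h1, h2] <;> omega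

lemma filter_lt_n (P : Finset (Fin n)) : P.filter (fun i : Fin n => (i : ℕ) < n) = P := by
  ext; simp

lemma order_le {k : ℕ} (X Z : Finset (Fin n)) (hX : X.card = k) (hZ : Z.card = k)
    (h : ∀ t ≤ n, (Z.filter (fun i : Fin n => (i : ℕ) < t)).card ≤
      (X.filter (fun i : Fin n => (i : ℕ) < t)).card) (i : Fin k) :
    X.orderEmbOfFin hX i ≤ Z.orderEmbOfFin hZ i := by
  classical
  by_contra hlt
  rw [not_le] at hlt
  have h1 := h (X.orderEmbOfFin hX i) (X.orderEmbOfFin hX i).2.le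
  have h2 : (X.filter (fun j : Fin n => (j : ℕ) < (X.orderEmbOfFin hX i : Fin n))).card ≤ i := by
    have : X.filter (fun j : Fin n => (j : ℕ) < (X.orderEmbOfFin hX i : Fin n)) ⊆
        (Finset.Iio i).image (X.orderEmbOfFin hX) := by
      intro j hj
      simp only [Finset.mem_filter] at hj
      have hj1 : j ∈ Set.range (X.orderEmbOfFin hX) := by
        rw [Finset.range_orderEmbOfFin]; exact hj.1
      obtain ⟨l, rfl⟩ := hj1
      refine Finset.mem_image.2 ⟨l, ?_, rfl⟩
      rw [Finset.mem_Iio]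
      exact (X.orderEmbOfFin hX).lt_iff_lt.1 hj.2
    refine (Finset.card_le_card this).trans (Finset.card_image_le.trans ?_)
    rw [Fin.card_Iio]
  have h3 : (i : ℕ) + 1 ≤
      (Z.filter (fun j : Fin n => (j : ℕ) < (X.orderEmbOfFin hX i : Fin n))).card := by
    have : (Finset.Iic i).image (Z.orderEmbOfFin hZ) ⊆
        Z.filter (fun j : Fin n => (j : ℕ) < (X.orderEmbOfFin hX i : Fin n)) := by
      intro j hj
      obtain ⟨l, hl, rfl⟩ := Finset.mem_image.1 hj
      rw [Finset.mem_Iic] at hl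
      simp only [Finset.mem_filter]
      exact ⟨Finset.orderEmbOfFin_mem _ _ _,
        lt_of_le_of_lt ((Z.orderEmbOfFin hZ).le_iff_le.2 hl) hlt⟩
    refine le_trans ?_ (Finset.card_le_card this)
    rw [Finset.card_image_of_injective _ (Z.orderEmbOfFin hZ).injective, Fin.card_Iic]
  omega

lemma exists_triples (σ : Fin n → Bool) (k : ℕ) (hk : 3 * k ≤ n) (hg : Good σ k) :
    ∃ a b z : Fin k → Fin n, Function.Injective a ∧ Function.Injective b ∧ Function.Injective z ∧
      (∀ i, σ (a i) = true) ∧ (∀ i, σ (b i) = false) ∧ (∀ i j, a i ≠ z j) ∧ (∀ i j, b i ≠ z j) ∧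
      (∀ i, a i < z i) ∧ (∀ i, b i < z i) := by
  classical
  set P := Finset.univ.filter (fun j : Fin n => σ j = true) with hP
  set M := Finset.univ.filter (fun j : Fin n => σ j = false) with hM
  have cP : ∀ t, (P.filter (fun i : Fin n => (i : ℕ) < t)).card = cnt σ true t := by
    intro t; unfold cnt; congr 1; ext; simp [hP, and_comm]
  have cM : ∀ t, (M.filter (fun i : Fin n => (i : ℕ) < t)).card = cnt σ false t := by
    intro t; unfold cnt; congr 1; ext; simp [hM, and_comm]
  set A := firstK P k with hA
  set B := firstK M k with hB
  have cA : ∀ t ≤ n, (A.filter (fun i : Fin n => (i : ℕ) < t)).card = min k (cnt σ true t) :=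
    fun t ht => by rw [hA, card_firstK _ _ _ ht, cP]
  have cB : ∀ t ≤ n, (B.filter (fun i : Fin n => (i : ℕ) < t)).card = min k (cnt σ false t) :=
    fun t ht => by rw [hB, card_firstK _ _ _ ht, cM]
  have sA : ∀ j ∈ A, σ j = true := by
    intro j hj; have := Finset.filter_subset _ _ hj; simpa [hP] using this
  have sB : ∀ j ∈ B, σ j = false := by
    intro j hj; have := Finset.filter_subset _ _ hj; simpa [hM] using this
  have dAB : Disjoint A B := by
    rw [Finset.disjoint_left]; intro j h1 h2; have := sA j h1; have := sB j h2; simp_all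
  set F := (A ∪ B)ᶜ with hF
  have cF : ∀ t ≤ n, (A.filter (fun i : Fin n => (i : ℕ) < t)).card +
      (B.filter (fun i : Fin n => (i : ℕ) < t)).card +
      (F.filter (fun i : Fin n => (i : ℕ) < t)).card = t := by
    intro t ht
    rw [← Finset.card_union_of_disjoint (Finset.disjoint_filter_filter dAB),
      ← Finset.filter_union, ← Finset.card_union_of_disjoint, ← Finset.filter_union]
    · rw [hF, Finset.union_compl, Fin.card_filter_val_lt]; omega
    · exact Finset.disjoint_filter_filter (by rw [hF]; exact disjoint_compl_right)
  set E := firstK F (n - 3 * k) with hE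
  have cE : ∀ t ≤ n, (E.filter (fun i : Fin n => (i : ℕ) < t)).card =
      min (n - 3 * k) (F.filter (fun i : Fin n => (i : ℕ) < t)).card :=
    fun t ht => by rw [hE, card_firstK _ _ _ ht]
  have sE : E ⊆ F := Finset.filter_subset _ _
  set Z := F \ E with hZ
  have cZ : ∀ t, (Z.filter (fun i : Fin n => (i : ℕ) < t)).card +
      (E.filter (fun i : Fin n => (i : ℕ) < t)).card =
      (F.filter (fun i : Fin n => (i : ℕ) < t)).card := by
    intro t
    rw [← Finset.card_union_of_disjoint (Finset.disjoint_filter_filter Finset.sdiff_disjoint),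
      ← Finset.filter_union, Finset.sdiff_union_of_subset sE]
  have gn := hg n le_rfl
  have sn := cnt_add σ n le_rfl
  have kA : A.card = k := by
    have := cA n le_rfl; rw [filter_lt_n] at this; omega
  have kB : B.card = k := by
    have := cB n le_rfl; rw [filter_lt_n] at this; omega
  have kZ : Z.card = k := by
    have h1 := cZ n; have h2 := cE n le_rfl; have h3 := cF n le_rfl
    simp only [filter_lt_n] at h1 h2 h3
    omega
  have mA := fun i => Finset.orderEmbOfFin_mem A kA i
  have mB := fun i => Finset.orderEmbOfFin_mem B kB i
  have mZ := fun i => Finset.orderEmbOfFin_mem Z kZ i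
  have dZ : ∀ x ∈ Z, x ∉ A ∧ x ∉ B := by
    intro x hx
    have : x ∈ F := Finset.sdiff_subset hx
    simpa [hF] using this
  have nA : ∀ i j, A.orderEmbOfFin kA i ≠ Z.orderEmbOfFin kZ j := by
    intro i j e; have := (dZ _ (mZ j)).1; rw [← e] at this; exact this (mA i)
  have nB : ∀ i j, B.orderEmbOfFin kB i ≠ Z.orderEmbOfFin kZ j := by
    intro i j e; have := (dZ _ (mZ j)).2; rw [← e] at this; exact this (mB i)
  refine ⟨A.orderEmbOfFin kA, B.orderEmbOfFin kB, Z.orderEmbOfFin kZ,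
    (A.orderEmbOfFin kA).injective, (B.orderEmbOfFin kB).injective, (Z.orderEmbOfFin kZ).injective,
    fun i => sA _ (mA i), fun i => sB _ (mB i), nA, nB, ?_, ?_⟩
  · intro i
    refine lt_of_le_of_ne (order_le A Z kA kZ ?_ i) (nA i i)
    intro t ht
    have := cA t ht; have := cB t ht; have := cF t ht; have := cE t ht; have := cZ t
    have := hg t ht; have := cnt_add σ t ht
    omega
  · intro i
    refine lt_of_le_of_ne (order_le B Z kB kZ ?_ i) (nB i i)
    intro t ht
    have := cA t ht; have := cB t ht; have := cF t ht; have := cE t ht; have := cZ t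
    have := hg t ht; have := cnt_add σ t ht
    omega

lemma leftNapkin_eq [NeZero n] (s : Fin n) : leftNapkin s = s - 1 := by
  have h0 : 0 < n := s.pos
  apply Fin.ext
  rw [Fin.sub_def]
  simp only [leftNapkin]
  rw [Fin.val_one']
  rcases Nat.lt_or_ge 1 n with h | h
  · rw [Nat.mod_eq_of_lt h, add_comm]
  · have : n = 1 := by omega
    subst this; omega

lemma napkinless_of (σ : Fin n → Bool) (w : Equiv.Perm (Fin n)) (a z b : Fin n)
    (ha : σ a = true) (hb : σ b = false) (haz : a < z) (hbz : b < z)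
    (h1 : leftNapkin (w.symm z) = w.symm a) (h2 : leftNapkin (w.symm b) = w.symm z) :
    z ∈ napkinless σ w := by
  obtain ⟨C, R, L, I⟩ := inv_dine σ w
  have tri : ∀ j, j ∈ R ∨ j ∈ L ∨ j ∈ napkinless σ w := fun j => (I.hD j).1 (Finset.mem_univ j)
  have aR : a ∈ R := by
    by_contra hn
    obtain ⟨l, hl, hlt, e⟩ := I.h2 a (by have := tri a; tauto)
    rw [← h1] at e
    have := w.symm.injective (leftNapkin_inj e)
    subst this; exact absurd haz (not_lt.2 hlt.le)
  have bL : b ∈ L := by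
    by_contra hn
    obtain ⟨l, hl, hlt, e⟩ := I.h1 b (by have := tri b; tauto)
    rw [h2] at e
    have := w.symm.injective e
    subst this; exact absurd hbz (not_lt.2 hlt.le)
  rcases tri z with h | h | h
  · exact absurd h2.symm (I.hne z h b bL)
  · exact absurd h1.symm (I.hne a aR z h)
  · exact h

lemma exists_seating (hn : 3 ≤ n) (σ : Fin n → Bool) (k : ℕ) (hk : 3 * k ≤ n) (hg : Good σ k) :
    ∃ w : Equiv.Perm (Fin n), IsSeating w ∧ k ≤ nu σ w := by
  classical
  have : NeZero n := ⟨by omega⟩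
  obtain ⟨a, b, z, ia, ib, iz, sa, sb, naz, nbz, laz, lbz⟩ := exists_triples σ k hk hg
  have nab : ∀ i j, a i ≠ b j := by
    intro i j e; have h1 := sa i; have h2 := sb j; rw [e, h2] at h1; simp at h1
  let pos : Fin k × Fin 3 → Fin n := fun x => ⟨3 * x.1 + x.2, by
    have := x.1.2; have := x.2.2; omega⟩
  let din : Fin k × Fin 3 → Fin n := fun x => ![a x.1, z x.1, b x.1] x.2
  have hpos : Function.Injective pos := by
    rintro ⟨i, c⟩ ⟨i', c'⟩ h
    simp only [pos, Fin.mk.injEq] at h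
    have := c.2; have := c'.2
    exact Prod.ext (Fin.ext (by simp; omega)) (Fin.ext (by simp; omega))
  have hdin : Function.Injective din := by
    rintro ⟨i, c⟩ ⟨i', c'⟩ h
    simp only [din] at h
    fin_cases c <;> fin_cases c' <;> simp at h ⊢
    · exact ia h
    · exact naz _ _ h
    · exact nab _ _ h
    · exact naz _ _ h.symm
    · exact iz h
    · exact nbz _ _ h.symm
    · exact nab _ _ h.symm
    · exact nbz _ _ h
    · exact ib h
  let e : Set.range pos ≃ Set.range din :=
    (Equiv.ofInjective pos hpos).symm.trans (Equiv.ofInjective din hdin)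
  obtain ⟨w0, hw0⟩ : ∃ w0 : Equiv.Perm (Fin n), ∀ x, w0 (pos x) = din x := by
    refine ⟨Equiv.extendSubtype (p := fun x => x ∈ Set.range pos)
      (q := fun x => x ∈ Set.range din) e, fun x => ?_⟩
    rw [Equiv.extendSubtype_apply_of_mem (p := fun x => x ∈ Set.range pos)
      (q := fun x => x ∈ Set.range din) e (pos x) ⟨x, rfl⟩]
    have : (Equiv.ofInjective pos hpos).symm ⟨pos x, ⟨x, rfl⟩⟩ = x :=
      Equiv.ofInjective_symm_apply hpos x
    simp [e, this]
  let w : Equiv.Perm (Fin n) := (Equiv.addRight (w0.symm 0)).trans w0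
  have hw : ∀ x, w.symm (din x) = pos x - w0.symm 0 := by
    intro x
    rw [Equiv.symm_apply_eq]
    simp [w, hw0]
  refine ⟨w, ?_, ?_⟩
  · intro i hi
    have : i = 0 := Fin.ext (by simpa using hi)
    subst this
    simp [w]
  · have key : ∀ i, z i ∈ napkinless σ w := by
      intro i
      have pa := hw (i, 0)
      have pz := hw (i, 1)
      have pb := hw (i, 2)
      have v1 : ((1 : Fin n) : ℕ) = 1 := by rw [Fin.val_one']; exact Nat.mod_eq_of_lt (by omega)
      have q1 : pos (i, 1) = pos (i, 0) + 1 := by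
        apply Fin.ext
        rw [Fin.val_add_one_of_lt']
        · simp [pos]
        · simp [pos]; have := i.2; omega
      have q2 : pos (i, 2) = pos (i, 1) + 1 := by
        apply Fin.ext
        rw [Fin.val_add_one_of_lt']
        · simp [pos]
        · simp [pos]; have := i.2; omega
      simp only [din, Matrix.cons_val] at pa pz pb
      apply napkinless_of σ w (a i) (z i) (b i) (sa i) (sb i) (laz i) (lbz i)
      · rw [leftNapkin_eq, pa, pz, q1]; abel
      · rw [leftNapkin_eq, pb, pz, q2]; abel
    have : Finset.univ.image z ⊆ napkinless σ w := by
      intro x hx; obtain ⟨i, -, rfl⟩ := Finset.mem_image.1 hx; exact key i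
    have := Finset.card_le_card this
    rw [Finset.card_image_of_injective _ iz] at this
    simpa [nu] using this

lemma good_mono (σ : Fin n → Bool) {k k' : ℕ} (h : k ≤ k') (hg : Good σ k') : Good σ k := by
  intro t ht; have := hg t ht; omega

lemma le_nuMax_iff (hn : 3 ≤ n) (σ : Fin n → Bool) (k : ℕ) :
    k ≤ nuMax σ ↔ 3 * k ≤ n ∧ Good σ k := by
  constructor
  · intro h
    obtain ⟨w, hw, e⟩ := Finset.exists_mem_eq_sup
      (Finset.univ.filter fun w : Equiv.Perm (Fin n) => IsSeating w)
      ⟨1, Finset.mem_filter.2 ⟨Finset.mem_univ _, fun i hi => by simpa using hi⟩⟩ (nu σ)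
    have e' : nuMax σ = nu σ w := e
    obtain ⟨h1, h2⟩ := nu_upper σ w
    rw [e'] at h
    exact ⟨by omega, good_mono σ h h2⟩
  · rintro ⟨h1, h2⟩
    obtain ⟨w, hw, e⟩ := exists_seating hn σ k h1 h2
    exact e.trans (Finset.le_sup (f := nu σ) (by simpa using hw))

/-! ### Counting -/

lemma cnt_zero (σ : Fin n → Bool) (b : Bool) : cnt σ b 0 = 0 := by simp [cnt]

lemma cnt_cons {m : ℕ} (c : Bool) (σ : Fin m → Bool) (b : Bool) (t : ℕ) :
    cnt (Fin.cons c σ : Fin (m + 1) → Bool) b (t + 1) = cnt σ b t + if c = b then 1 else 0 := by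
  unfold cnt
  rw [Finset.card_filter, Finset.card_filter, Fin.sum_univ_succ]
  simp [add_comm]

lemma sum_choose_succ (m k : ℕ) :
    ∑ i ∈ Finset.range (k + 1), (m + 1).choose i =
      ∑ i ∈ Finset.range (k + 1), m.choose i + ∑ i ∈ Finset.range k, m.choose i := by
  rw [Finset.sum_range_succ', Finset.sum_range_succ' (fun i => m.choose i)]
  simp only [Nat.choose_succ_succ, Finset.sum_add_distrib, Nat.choose_zero_right]
  ring

open Classical in
lemma count_bad (b : Bool) (m : ℕ) : ∀ k, 2 * k ≤ m + 1 →
    (Finset.univ.filter (fun σ : Fin m → Bool =>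
      ∃ t ≤ m, m + 1 + cnt σ (!b) t ≤ cnt σ b t + 2 * k)).card =
      2 * ∑ i ∈ Finset.range k, m.choose i := by
  induction m with
  | zero =>
    intro k hk
    have : k = 0 := by omega
    subst this
    simp [cnt_zero]
  | succ m ih =>
    intro k hk
    rcases Nat.eq_zero_or_pos k with rfl | hpos
    · simp only [Finset.range_zero, Finset.sum_empty, mul_zero, Finset.card_eq_zero,
        Finset.filter_eq_empty_iff]
      rintro σ - ⟨t, ht, h⟩
      have := cnt_add σ t ht
      cases b <;> simp at h <;> omega
    obtain ⟨k, rfl⟩ : ∃ k', k = k' + 1 := ⟨k - 1, by omega⟩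
    by_cases hk2 : 2 * (k + 1) = m + 2
    · have hm : m = 2 * k := by omega
      subst hm
      rw [Nat.sum_range_choose_halfway, Finset.filter_true_of_mem]
      · simp [pow_succ, pow_mul]; ring
      · intro σ _; exact ⟨0, by omega, by simp only [cnt_zero]; omega⟩
    · rw [sum_choose_succ, Nat.mul_add 2 (∑ i ∈ Finset.range (k + 1), m.choose i), ← ih (k + 1) (by omega), ← ih k (by omega)]
      have e1 : ∀ σ : Fin m → Bool,
          (∃ t ≤ m + 1, m + 1 + 1 + cnt (Fin.cons b σ : Fin (m + 1) → Bool) (!b) t ≤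
            cnt (Fin.cons b σ : Fin (m + 1) → Bool) b t + 2 * (k + 1)) ↔
          ∃ t ≤ m, m + 1 + cnt σ (!b) t ≤ cnt σ b t + 2 * (k + 1) := by
        intro σ
        constructor
        · rintro ⟨t, ht, h⟩
          cases t with
          | zero => simp only [cnt_zero] at h; omega
          | succ t => simp only [cnt_cons] at h; exact ⟨t, by omega, by simp at h; omega⟩
        · rintro ⟨t, ht, h⟩
          exact ⟨t + 1, by omega, by simp only [cnt_cons]; simp; omega⟩
      have e2 : ∀ σ : Fin m → Bool,
          (∃ t ≤ m + 1, m + 1 + 1 + cnt (Fin.cons (!b) σ : Fin (m + 1) → Bool) (!b) t ≤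
            cnt (Fin.cons (!b) σ : Fin (m + 1) → Bool) b t + 2 * (k + 1)) ↔
          ∃ t ≤ m, m + 1 + cnt σ (!b) t ≤ cnt σ b t + 2 * k := by
        intro σ
        constructor
        · rintro ⟨t, ht, h⟩
          cases t with
          | zero => simp only [cnt_zero] at h; omega
          | succ t => simp only [cnt_cons] at h; exact ⟨t, by omega, by simp at h; omega⟩
        · rintro ⟨t, ht, h⟩
          exact ⟨t + 1, by omega, by simp only [cnt_cons]; simp; omega⟩
      simp only [Finset.card_filter]
      rw [← (Fin.consEquiv (fun _ : Fin (m + 1) => Bool)).sum_comp, Fintype.sum_prod_type]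
      rw [Fintype.sum_bool]
      simp only [← e1, ← e2]
      cases b
      · rw [add_comm]; rfl
      · rfl

open Classical in
lemma count_good (k : ℕ) (hk : 3 * k ≤ n) :
    (Finset.univ.filter (fun σ : Fin n → Bool => Good σ k)).card +
      4 * ∑ i ∈ Finset.range k, n.choose i = 2 ^ n := by
  have h1 := count_bad true n k (by omega)
  have h2 := count_bad false n k (by omega)
  have h3 : (Finset.univ.filter (fun σ : Fin n → Bool => ¬ Good σ k)) =
      (Finset.univ.filter (fun σ : Fin n → Bool =>
        ∃ t ≤ n, n + 1 + cnt σ (!true) t ≤ cnt σ true t + 2 * k)) ∪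
      (Finset.univ.filter (fun σ : Fin n → Bool =>
        ∃ t ≤ n, n + 1 + cnt σ (!false) t ≤ cnt σ false t + 2 * k)) := by
    ext σ
    simp only [Finset.mem_filter, Finset.mem_union, Finset.mem_univ, true_and, Bool.not_true,
      Bool.not_false]
    unfold Good
    constructor
    · intro h
      push Not at h
      obtain ⟨t, ht, h⟩ := h
      by_cases hh : cnt σ true t + 2 * k ≤ n + cnt σ false t
      · exact Or.inr ⟨t, ht, by have := h hh; omega⟩
      · exact Or.inl ⟨t, ht, by omega⟩
    · rintro (⟨t, ht, h⟩ | ⟨t, ht, h⟩) hg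
      · have := hg t ht; omega
      · have := hg t ht; omega
  have h4 : Disjoint
      (Finset.univ.filter (fun σ : Fin n → Bool =>
        ∃ t ≤ n, n + 1 + cnt σ (!true) t ≤ cnt σ true t + 2 * k))
      (Finset.univ.filter (fun σ : Fin n → Bool =>
        ∃ t ≤ n, n + 1 + cnt σ (!false) t ≤ cnt σ false t + 2 * k)) := by
    rw [Finset.disjoint_left]
    intro σ h h'
    simp only [Finset.mem_filter, Finset.mem_univ, true_and, Bool.not_true, Bool.not_false] at h h'
    obtain ⟨t, ht, h⟩ := h
    obtain ⟨t', ht', h'⟩ := h'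
    have := cnt_add σ t ht
    have := cnt_add σ t' ht'
    rcases le_total t t' with hh | hh
    · have := cnt_mono σ true hh
      have := cnt_mono σ false hh
      omega
    · have := cnt_mono σ true hh
      have := cnt_mono σ false hh
      omega
  have h5 := congrArg Finset.card h3
  rw [Finset.card_union_of_disjoint h4, h1, h2] at h5
  have h6 : (Finset.univ.filter (fun σ : Fin n → Bool => Good σ k)).card +
    (Finset.univ.filter (fun σ : Fin n → Bool => ¬ Good σ k)).card = _ :=
    Finset.card_filter_add_card_filter_not _
  rw [Finset.card_univ, Fintype.card_fun, Fintype.card_bool, Fintype.card_fin] at h6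
  omega

theorem statement13 (n : ℕ) (hn : 3 ≤ n) (q : ℕ) (hq : q = n / 3)
    (p : ℕ → ℕ)
    (hp : ∀ k, p k = ((Finset.univ : Finset (Fin n → Bool)).filter
        fun σ => nuMax σ = k).card) :
    (∀ k < q, p k = 4 * n.choose k) ∧
    (p q = 2 ^ n - 4 * ∑ i ∈ Finset.range q, n.choose i) ∧
    (∀ k > q, p k = 0) := by
  classical
  refine ⟨?_, ?_, ?_⟩
  · intro k hk
    have g1 := count_good (n := n) k (by omega)
    have g2 := count_good (n := n) (k + 1) (by omega)
    have : (Finset.univ.filter (fun σ : Fin n → Bool => Good σ k)) =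
        ((Finset.univ : Finset (Fin n → Bool)).filter fun σ => nuMax σ = k) ∪
        (Finset.univ.filter (fun σ : Fin n → Bool => Good σ (k + 1))) := by
      ext σ
      have a1 := le_nuMax_iff hn σ k
      have a2 := le_nuMax_iff hn σ (k + 1)
      have b1 : 3 * k ≤ n := by omega
      have b2 : 3 * (k + 1) ≤ n := by omega
      simp only [b1, b2, true_and] at a1 a2
      simp only [Finset.mem_filter, Finset.mem_union, Finset.mem_univ, true_and, ← a1, ← a2]
      omega
    have h5 := congrArg Finset.card this
    rw [Finset.card_union_of_disjoint, ← hp k] at h5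
    · rw [Finset.sum_range_succ] at g2
      omega
    · rw [Finset.disjoint_left]
      intro σ h h'
      simp only [Finset.mem_filter, Finset.mem_univ, true_and] at h h'
      have := (le_nuMax_iff hn σ (k + 1)).2 ⟨by omega, h'⟩
      omega
  · have g1 := count_good (n := n) q (by omega)
    have : ((Finset.univ : Finset (Fin n → Bool)).filter fun σ => nuMax σ = q) =
        (Finset.univ.filter (fun σ : Fin n → Bool => Good σ q)) := by
      ext σ
      have a1 := le_nuMax_iff hn σ q
      have a2 := (le_nuMax_iff hn σ (nuMax σ)).1 le_rfl
      have b1 : 3 * q ≤ n := by omega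
      simp only [b1, true_and] at a1
      simp only [Finset.mem_filter, Finset.mem_univ, true_and, ← a1]
      omega
    rw [hp, this]
    omega
  · intro k hk
    rw [hp, Finset.card_eq_zero, Finset.filter_eq_empty_iff]
    intro σ _ e
    have a2 := (le_nuMax_iff hn σ (nuMax σ)).1 le_rfl
    omega

end Napkin
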